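/- arXiv:1805.04505 — 2 statements merged into one kernel-verified Lean document; each statement's English description precedes it below -/
import Mathlib

section
/- Let n ≥ 2 be an integer, ρ ∈ (0,1) fixed, and a_n = 3(n-1)/(n+1). For c > 0 set r_c = 1 + 2ρ²/(c(1-ρ²)). Then the limit as c → ∞ of c^{n+1}·P_{n,c}(r_c) equals (4ρ²/(1-ρ²)²)·(4ρ²/(1-ρ²))^{n-1}·(1 + a_nρ²). -/
open Real Filter Set

/-- `Q k r = r * ∫_1^r t⁻²(t²-1)^k dt`. -/
noncomputable def Q (k : ℕ) (r : ℝ) : ℝ :=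
  r * ∫ t in (1:ℝ)..r, (t ^ 2 - 1) ^ k / t ^ 2

/-- `P_{n,c} = (2n-1)Q_n + (2n/c)Q_{n-1}`. -/
noncomputable def P (n : ℕ) (c r : ℝ) : ℝ :=
  (2 * (n : ℝ) - 1) * Q n r + (2 * (n : ℝ) / c) * Q (n - 1) r

theorem integral_sub_one_pow (k : ℕ) (r : ℝ) :
    ∫ t in (1:ℝ)..r, (t - 1) ^ k = (r - 1) ^ (k + 1) / (k + 1) := by
  rw [intervalIntegral.integral_comp_sub_right (fun t => t ^ k), integral_pow]
  simp

theorem intervalIntegrable_Q_integrand (k : ℕ) {r : ℝ} (hr : 1 ≤ r) :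
    IntervalIntegrable (fun t : ℝ => (t ^ 2 - 1) ^ k / t ^ 2) MeasureTheory.volume 1 r := by
  apply ContinuousOn.intervalIntegrable_of_Icc hr
  refine ContinuousOn.div (by fun_prop) (by fun_prop) fun t ht => ?_
  have : 0 < t := by linarith [ht.1]
  positivity

theorem le_Q (k : ℕ) {r : ℝ} (hr : 1 ≤ r) :
    r * (2 ^ k / r ^ 2 * ((r - 1) ^ (k + 1) / (k + 1))) ≤ Q k r := by
  rw [Q, ← integral_sub_one_pow, ← intervalIntegral.integral_const_mul]
  refine mul_le_mul_of_nonneg_left ?_ (by linarith)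
  refine intervalIntegral.integral_mono_on hr (Continuous.intervalIntegrable (by fun_prop) _ _)
    (intervalIntegrable_Q_integrand k hr) fun t ht => ?_
  have h1 : 0 ≤ t - 1 := by linarith [ht.1]
  have h0 : 0 < t := by linarith
  rw [div_mul_eq_mul_div, ← mul_pow]
  have h2 : 2 * (t - 1) ≤ t ^ 2 - 1 := by nlinarith
  have h3 : t ≤ r := ht.2
  have h4 : 0 ≤ t ^ 2 - 1 := by nlinarith
  gcongr

theorem Q_le (k : ℕ) {r : ℝ} (hr : 1 ≤ r) :
    Q k r ≤ r * ((r + 1) ^ k * ((r - 1) ^ (k + 1) / (k + 1))) := by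
  rw [Q, ← integral_sub_one_pow, ← intervalIntegral.integral_const_mul ((r + 1) ^ k)]
  refine mul_le_mul_of_nonneg_left ?_ (by linarith)
  refine intervalIntegral.integral_mono_on hr (intervalIntegrable_Q_integrand k hr)
    (Continuous.intervalIntegrable (by fun_prop) _ _) fun t ht => ?_
  have h1 : 0 ≤ t - 1 := by linarith [ht.1]
  have h2 : 0 ≤ t ^ 2 - 1 := by nlinarith
  have h3 : t ^ 2 - 1 ≤ (r + 1) * (t - 1) := by nlinarith [ht.2]
  rw [← mul_pow]
  have h4 : 1 ≤ t ^ 2 := by linarith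
  exact (div_le_self (pow_nonneg h2 k) h4).trans (pow_le_pow_left₀ h2 h3 k)

theorem tendsto_pow_mul_Q (k : ℕ) {d : ℝ} (hd : 0 ≤ d) :
    Tendsto (fun c : ℝ => c ^ (k + 1) * Q k (1 + d / c)) atTop
      (nhds (2 ^ k * (d ^ (k + 1) / (k + 1)))) := by
  have hr : Tendsto (fun c : ℝ => 1 + d / c) atTop (nhds 1) := by
    simpa using (tendsto_const_nhds (x := (1 : ℝ))).add (tendsto_id.const_div_atTop d)
  have hlow : Tendsto (fun r : ℝ => r * (2 ^ k / r ^ 2 * (d ^ (k + 1) / (k + 1)))) (nhds 1)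
      (nhds (2 ^ k * (d ^ (k + 1) / (k + 1)))) := by
    have : ContinuousAt (fun r : ℝ => r * (2 ^ k / r ^ 2 * (d ^ (k + 1) / (k + 1)))) 1 := by
      fun_prop (disch := norm_num)
    simpa [ContinuousAt] using this
  have hupp : Tendsto (fun r : ℝ => r * ((r + 1) ^ k * (d ^ (k + 1) / (k + 1)))) (nhds 1)
      (nhds (2 ^ k * (d ^ (k + 1) / (k + 1)))) := by
    have : ContinuousAt (fun r : ℝ => r * ((r + 1) ^ k * (d ^ (k + 1) / (k + 1)))) 1 := by
      fun_prop (disch := positivity)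
    simpa [ContinuousAt, one_add_one_eq_two] using this
  refine tendsto_of_tendsto_of_tendsto_of_le_of_le' (hlow.comp hr) (hupp.comp hr) ?_ ?_ <;>
    filter_upwards [eventually_gt_atTop 0] with c hc <;>
    have h1 : 1 ≤ 1 + d / c := le_add_of_nonneg_right (by positivity) <;>
    have hs : d ^ (k + 1) = c ^ (k + 1) * (1 + d / c - 1) ^ (k + 1) := by
      rw [← mul_pow]; congr 1; field_simp; ring
  · refine le_trans (le_of_eq ?_) (mul_le_mul_of_nonneg_left (le_Q k h1) (by positivity))
    simp only [Function.comp_apply, hs]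
    ring
  · refine (mul_le_mul_of_nonneg_left (Q_le k h1) (by positivity)).trans (le_of_eq ?_)
    simp only [Function.comp_apply, hs]
    ring

/-- With `r_c = 1 + 2ρ²/(c(1-ρ²))` and `a_n = 3(n-1)/(n+1)`,
`c^(n+1)·P_{n,c}(r_c) → (4ρ²/(1-ρ²)²)(4ρ²/(1-ρ²))^(n-1)(1 + a_nρ²)` as `c → ∞`. -/
theorem stmt_13 (n : ℕ) (hn : 2 ≤ n) (ρ : ℝ) (hρ : ρ ∈ Set.Ioo (0 : ℝ) 1)
    (a : ℝ) (ha : a = 3 * ((n : ℝ) - 1) / ((n : ℝ) + 1)) :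
    Tendsto (fun c : ℝ => c ^ (n + 1) * P n c (1 + 2 * ρ ^ 2 / (c * (1 - ρ ^ 2))))
      atTop
      (nhds ((4 * ρ ^ 2 / (1 - ρ ^ 2) ^ 2) * (4 * ρ ^ 2 / (1 - ρ ^ 2)) ^ (n - 1)
        * (1 + a * ρ ^ 2))) := by
  obtain ⟨m, rfl⟩ : ∃ m, n = m + 1 := ⟨n - 1, by omega⟩
  obtain ⟨h0, h1⟩ := hρ
  have hw : 0 < 1 - ρ ^ 2 := by nlinarith
  have hd : 0 ≤ 2 * ρ ^ 2 / (1 - ρ ^ 2) := by positivity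
  have key := ((tendsto_pow_mul_Q (m + 1) hd).const_mul (2 * ((m + 1 : ℕ) : ℝ) - 1)).add
    ((tendsto_pow_mul_Q m hd).const_mul (2 * ((m + 1 : ℕ) : ℝ)))
  have hlim : (4 * ρ ^ 2 / (1 - ρ ^ 2) ^ 2) * (4 * ρ ^ 2 / (1 - ρ ^ 2)) ^ (m + 1 - 1)
        * (1 + a * ρ ^ 2) = (2 * ((m + 1 : ℕ) : ℝ) - 1) * (2 ^ (m + 1) *
        ((2 * ρ ^ 2 / (1 - ρ ^ 2)) ^ (m + 1 + 1) / ((m + 1 : ℕ) + 1))) +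
        2 * ((m + 1 : ℕ) : ℝ) * (2 ^ m * ((2 * ρ ^ 2 / (1 - ρ ^ 2)) ^ (m + 1) / (m + 1))) := by
    have hx : 4 * ρ ^ 2 / (1 - ρ ^ 2) = 2 * (2 * ρ ^ 2 / (1 - ρ ^ 2)) := by ring
    have hm : (m : ℝ) + 1 + 1 ≠ 0 := by positivity
    rw [hx, mul_pow, ha, Nat.add_sub_cancel, pow_succ _ (m + 1), pow_succ _ m,
      pow_succ _ m]
    generalize (2 * ρ ^ 2 / (1 - ρ ^ 2)) ^ m = y
    push_cast
    field_simp
    ring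
  rw [hlim]
  refine key.congr' ?_
  filter_upwards [eventually_gt_atTop 0] with c hc
  have hr : 2 * ρ ^ 2 / (c * (1 - ρ ^ 2)) = 2 * ρ ^ 2 / (1 - ρ ^ 2) / c := by
    field_simp
  rw [P, hr, Nat.add_sub_cancel]
  field_simp
  ring
end

section
/- Let n ≥ 2 be an integer, t > 0 fixed, and b_n = 2n/(2n-3). For c > 0 set r_c = c^{-1/2}t + 1. Then as c → 0⁺: c·(r_c²-1) tends to t², c²·(r_c²-1)^{-n+1}·P_{n,c}(r_c) tends to 0, and c^{-1}·(r_c²-1)^{n-1}/P_{n,c}(r_c) tends to 1/(t²+b_n). (These are the limits of the metric coefficients γ², β², α̃² of g_c in the coordinate t, showing collapse of the circle fibers and convergence of the base metric to dt²/(t²+b_n) + t²g_{CP^{n-1}}.) -/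
open Real Filter Set

theorem Q_succ_le (j : ℕ) {r : ℝ} (hr : 1 ≤ r) :
    Q (j + 1) r ≤ r ^ (2 * j + 2) / (2 * j + 1) := by
  have hint : IntervalIntegrable (fun t : ℝ => (t ^ 2 - 1) ^ (j + 1) / t ^ 2)
      MeasureTheory.volume 1 r := by
    apply ContinuousOn.intervalIntegrable_of_Icc hr
    refine ContinuousOn.div (by fun_prop) (by fun_prop) fun x hx => ?_
    have : 0 < x := by linarith [hx.1]
    positivity
  have h : ∫ t in (1 : ℝ)..r, (t ^ 2 - 1) ^ (j + 1) / t ^ 2 ≤ ∫ t in (1 : ℝ)..r, t ^ (2 * j) := by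
    refine intervalIntegral.integral_mono_on hr hint
      (by apply Continuous.intervalIntegrable; fun_prop) fun x hx => ?_
    have hx0 : 0 < x := by linarith [hx.1]
    have hx1 : 1 ≤ x ^ 2 := one_le_pow₀ hx.1
    rw [div_le_iff₀ (by positivity)]
    calc (x ^ 2 - 1) ^ (j + 1) ≤ (x ^ 2) ^ (j + 1) := by gcongr; linarith
      _ = x ^ (2 * j) * x ^ 2 := by ring
  rw [integral_pow] at h
  push_cast at h
  have hr0 : 0 ≤ r := by linarith
  calc Q (j + 1) r ≤ r * ((r ^ (2 * j + 1) - 1 ^ (2 * j + 1)) / (2 * j + 1)) :=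
        mul_le_mul_of_nonneg_left h hr0
    _ ≤ r * (r ^ (2 * j + 1) / (2 * j + 1)) := by gcongr; simp
    _ = r ^ (2 * j + 2) / (2 * j + 1) := by ring

theorem le_Q_succ (j : ℕ) {r : ℝ} (hr : 1 ≤ r) :
    r * ((r ^ (2 * j + 1) - 1) / (2 * j + 1) - (j + 1) * r ^ (2 * j)) ≤ Q (j + 1) r := by
  have hne : ∀ x ∈ Icc 1 r, x ^ 2 ≠ 0 := fun x hx => by
    have : 0 < x := by linarith [hx.1]
    positivity
  have hr0 : 0 < r := by linarith
  have hint : IntervalIntegrable (fun t : ℝ => (t ^ 2 - 1) ^ (j + 1) / t ^ 2)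
      MeasureTheory.volume 1 r :=
    ContinuousOn.intervalIntegrable_of_Icc hr
      (ContinuousOn.div (by fun_prop) (by fun_prop) hne)
  have hint2 : IntervalIntegrable (fun t : ℝ => ((j : ℝ) + 1) * r ^ (2 * j) * t ^ (-2 : ℤ))
      MeasureTheory.volume 1 r := by
    apply ContinuousOn.intervalIntegrable_of_Icc hr
    refine continuousOn_const.mul (ContinuousOn.zpow₀ continuousOn_id _ fun x hx => ?_)
    left
    have : 0 < x := by linarith [hx.1]
    exact this.ne'
  have hint1 : IntervalIntegrable (fun t : ℝ => t ^ (2 * j)) MeasureTheory.volume 1 r := by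
    apply Continuous.intervalIntegrable; fun_prop
  have h : ∫ t in (1 : ℝ)..r, (t ^ (2 * j) - ((j : ℝ) + 1) * r ^ (2 * j) * t ^ (-2 : ℤ))
      ≤ ∫ t in (1 : ℝ)..r, (t ^ 2 - 1) ^ (j + 1) / t ^ 2 := by
    refine intervalIntegral.integral_mono_on hr (hint1.sub hint2) hint fun x hx => ?_
    have hx0 : 0 < x := by linarith [hx.1]
    have hx1 : 1 ≤ x ^ 2 := one_le_pow₀ hx.1
    have hxr : x ^ (2 * j) ≤ r ^ (2 * j) := by gcongr; exact hx.2
    have hinv : (x ^ 2)⁻¹ ≤ 1 := inv_le_one_of_one_le₀ hx1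
    have bern := one_add_mul_le_pow (a := -(x ^ 2)⁻¹) (by linarith) (j + 1)
    push_cast at bern
    have e : (x ^ 2 - 1) ^ (j + 1) / x ^ 2 = x ^ (2 * j) * (1 + -(x ^ 2)⁻¹) ^ (j + 1) := by
      have : x ^ 2 - 1 = x ^ 2 * (1 + -(x ^ 2)⁻¹) := by field_simp; ring
      rw [this, mul_pow]
      field_simp
      ring
    rw [e, show x ^ (-2 : ℤ) = (x ^ 2)⁻¹ from by rw [zpow_neg]; norm_cast]
    calc x ^ (2 * j) - ((j : ℝ) + 1) * r ^ (2 * j) * (x ^ 2)⁻¹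
        ≤ x ^ (2 * j) - ((j : ℝ) + 1) * x ^ (2 * j) * (x ^ 2)⁻¹ := by gcongr
      _ = x ^ (2 * j) * (1 + ((j : ℝ) + 1) * -(x ^ 2)⁻¹) := by ring
      _ ≤ _ := by gcongr
  rw [intervalIntegral.integral_sub hint1 hint2, intervalIntegral.integral_const_mul, integral_pow,
    integral_zpow (Or.inr ⟨by norm_num, by
      rw [uIcc_of_le hr]; exact fun h0 => by linarith [h0.1]⟩)] at h
  push_cast at h
  refine mul_le_mul_of_nonneg_left (le_trans ?_ h) hr0.le
  rw [one_pow]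
  have h2 : (r ^ ((-2 : ℤ) + 1) - 1 ^ ((-2 : ℤ) + 1)) / ((-2 : ℝ) + 1) ≤ 1 := by
    have : 0 < r ^ ((-2 : ℤ) + 1) := by positivity
    rw [one_zpow]
    rw [div_le_iff_of_neg (by norm_num)]
    linarith
  have h3 : (0 : ℝ) ≤ (j + 1) * r ^ (2 * j) := by positivity
  exact sub_le_sub_left (mul_le_of_le_one_right h3 h2) _

theorem tendsto_Q_succ_div_pow (j : ℕ) :
    Tendsto (fun r : ℝ => Q (j + 1) r / r ^ (2 * j + 2)) atTop (nhds (1 / (2 * j + 1))) := by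
  have hlow : Tendsto (fun r : ℝ => (1 - (r ^ (2 * j + 1))⁻¹) / (2 * j + 1) - (j + 1) * r⁻¹) atTop
      (nhds ((1 - 0) / (2 * j + 1) - (j + 1) * 0)) :=
    ((tendsto_const_nhds.sub (tendsto_inv_atTop_zero.comp
      (tendsto_pow_atTop (by omega)))).div_const _).sub
      (tendsto_inv_atTop_zero.const_mul _)
  simp only [sub_zero, mul_zero] at hlow
  refine tendsto_of_tendsto_of_tendsto_of_le_of_le' hlow tendsto_const_nhds ?_ ?_
  · filter_upwards [eventually_ge_atTop 1] with r hr
    have hr0 : 0 < r := by linarith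
    rw [le_div_iff₀ (by positivity)]
    refine le_of_eq_of_le ?_ (le_Q_succ j hr)
    field_simp
    ring
  · filter_upwards [eventually_ge_atTop 1] with r hr
    have hr0 : 0 < r := by linarith
    rw [div_le_iff₀ (by positivity)]
    refine (Q_succ_le j hr).trans_eq ?_
    ring

theorem tendsto_div_sqrt_add_one {t : ℝ} (ht : 0 < t) :
    Tendsto (fun c : ℝ => t / √c + 1) (nhdsWithin 0 (Ioi 0)) atTop := by
  have hs : Tendsto (fun c : ℝ => √c) (nhdsWithin 0 (Ioi 0)) (nhdsWithin 0 (Ioi 0)) := by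
    refine tendsto_nhdsWithin_iff.2 ⟨?_, ?_⟩
    · simpa using (Real.continuous_sqrt.tendsto 0).mono_left nhdsWithin_le_nhds
    · filter_upwards [self_mem_nhdsWithin] with c hc using Real.sqrt_pos.2 hc
  exact tendsto_atTop_add_const_right _ _
    ((tendsto_inv_nhdsGT_zero.comp hs).const_mul_atTop ht)

theorem tendsto_mul_div_sqrt_add_one_sq (t : ℝ) :
    Tendsto (fun c : ℝ => c * (t / √c + 1) ^ 2) (nhdsWithin 0 (Ioi 0)) (nhds (t ^ 2)) := by
  have h : Tendsto (fun c : ℝ => (t + √c) ^ 2) (nhdsWithin 0 (Ioi 0)) (nhds (t ^ 2)) := by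
    have : Continuous fun c : ℝ => (t + √c) ^ 2 := by fun_prop
    simpa using (this.tendsto 0).mono_left nhdsWithin_le_nhds
  refine h.congr' ?_
  filter_upwards [self_mem_nhdsWithin] with c hc
  have hs : 0 < √c := Real.sqrt_pos.2 hc
  nth_rewrite 2 [← Real.sq_sqrt (le_of_lt hc)]
  field_simp

theorem tendsto_mul_P_div_pow (j : ℕ) {t : ℝ} (ht : 0 < t) :
    Tendsto (fun c : ℝ => c * P (j + 2) c (t / √c + 1) / ((t / √c + 1) ^ 2 - 1) ^ (j + 1))
      (nhdsWithin 0 (Ioi 0)) (nhds (t ^ 2 + (2 * j + 4) / (2 * j + 1))) := by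
  have hr := tendsto_div_sqrt_add_one ht
  have hQ := (tendsto_Q_succ_div_pow (j + 1)).comp hr
  have hQ' := (tendsto_Q_succ_div_pow j).comp hr
  have hratio : Tendsto (fun r : ℝ => (1 - (r ^ 2)⁻¹)⁻¹ ^ (j + 1)) atTop
      (nhds ((1 - 0)⁻¹ ^ (j + 1))) :=
    ((tendsto_const_nhds.sub (tendsto_inv_atTop_zero.comp
      (tendsto_pow_atTop two_ne_zero))).inv₀ (by norm_num)).pow _
  have hS := hratio.comp hr
  have hmain := ((((hQ.mul (tendsto_mul_div_sqrt_add_one_sq t)).const_mul (2 * j + 3 : ℝ)).add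
    (hQ'.const_mul (2 * j + 4 : ℝ))).mul hS)
  have hlim : ((2 * j + 3 : ℝ) * (1 / (2 * ((j + 1 : ℕ) : ℝ) + 1) * t ^ 2)
      + (2 * j + 4) * (1 / (2 * j + 1))) * (1 - 0)⁻¹ ^ (j + 1)
      = t ^ 2 + (2 * j + 4) / (2 * j + 1) := by
    have h1 : (2 * ((j + 1 : ℕ) : ℝ) + 1) = 2 * j + 3 := by push_cast; ring
    have h2 : (2 * j + 3 : ℝ) ≠ 0 := by positivity
    rw [h1, sub_zero, inv_one, one_pow]
    field_simp
  rw [hlim] at hmain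
  refine hmain.congr' ?_
  filter_upwards [self_mem_nhdsWithin, hr.eventually_gt_atTop 1] with c hc hr1
  have hc0 : c ≠ 0 := ne_of_gt hc
  simp only [Function.comp_apply, P, show j + 2 - 1 = j + 1 from rfl]
  generalize t / √c + 1 = r at hr1
  have hr0 : r ≠ 0 := by linarith
  have hpos : r ^ 2 - 1 ≠ 0 := by nlinarith
  have e : (1 - (r ^ 2)⁻¹)⁻¹ = r ^ 2 / (r ^ 2 - 1) := by
    rw [show 1 - (r ^ 2)⁻¹ = (r ^ 2 - 1) / r ^ 2 by field_simp, inv_div]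
  rw [e, div_pow, show j + 1 + 1 = j + 2 from rfl]
  generalize Q (j + 2) r = A
  generalize Q (j + 1) r = B
  have hp := pow_ne_zero (j + 1) hpos
  generalize (r ^ 2 - 1) ^ (j + 1) = S at hp
  push_cast
  rw [← pow_mul, show 2 * (j + 1) + 2 = 2 * j + 2 + 2 by ring, pow_add r (2 * j + 2) 2,
    show 2 * (j + 1) = 2 * j + 2 by ring]
  have hp' := pow_ne_zero (2 * j + 2) hr0
  generalize r ^ (2 * j + 2) = R at hp'
  field_simp
  ring

/-- With `r_c = c^(-1/2)t + 1` and `b_n = 2n/(2n-3)`, as `c → 0⁺`: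
`c(r_c²-1) → t²`, `c²(r_c²-1)^(-n+1)P_{n,c}(r_c) → 0`, and
`c⁻¹(r_c²-1)^(n-1)/P_{n,c}(r_c) → 1/(t²+b_n)`. -/
theorem stmt_17 (n : ℕ) (hn : 2 ≤ n) (t : ℝ) (ht : 0 < t)
    (b : ℝ) (hb : b = 2 * (n : ℝ) / (2 * (n : ℝ) - 3)) :
    Tendsto (fun c : ℝ => c * ((t / Real.sqrt c + 1) ^ 2 - 1))
      (nhdsWithin 0 (Set.Ioi 0)) (nhds (t ^ 2)) ∧
    Tendsto (fun c : ℝ =>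
        c ^ 2 * ((t / Real.sqrt c + 1) ^ 2 - 1) ^ (-(n : ℤ) + 1)
          * P n c (t / Real.sqrt c + 1))
      (nhdsWithin 0 (Set.Ioi 0)) (nhds 0) ∧
    Tendsto (fun c : ℝ =>
        c⁻¹ * ((t / Real.sqrt c + 1) ^ 2 - 1) ^ (n - 1)
          / P n c (t / Real.sqrt c + 1))
      (nhdsWithin 0 (Set.Ioi 0)) (nhds (1 / (t ^ 2 + b))) := by
  obtain ⟨j, rfl⟩ := Nat.exists_eq_add_of_le' hn
  have hr := tendsto_div_sqrt_add_one ht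
  have hP := tendsto_mul_P_div_pow j ht
  have hc : Tendsto (fun c : ℝ => c) (nhdsWithin 0 (Ioi 0)) (nhds 0) :=
    tendsto_id.mono_left nhdsWithin_le_nhds
  have hb' : (2 * j + 4 : ℝ) / (2 * j + 1) = b := by
    rw [hb]
    push_cast
    congr 1 <;> ring
  rw [hb'] at hP
  have hb0 : 0 < b := by rw [← hb']; positivity
  refine ⟨?_, ?_, ?_⟩
  · simpa [mul_sub] using (tendsto_mul_div_sqrt_add_one_sq t).sub hc
  · have h := hc.mul hP
    rw [zero_mul] at h
    refine h.congr fun c => ?_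
    rw [show -((j + 2 : ℕ) : ℤ) + 1 = -((j + 1 : ℕ) : ℤ) by push_cast; ring, zpow_neg,
      zpow_natCast]
    ring
  · have h := hP.inv₀ (by positivity)
    rw [one_div]
    refine h.congr fun c => ?_
    rw [inv_div, show j + 2 - 1 = j + 1 from rfl, div_mul_eq_div_div]
    ring
end
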